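/- Fix a real number p ≥ 2 and an integer n ≥ 1, and let φ_n be as defined in the context. Then φ_n is twice continuously differentiable on ℝ, and its second derivative is given by φ_n''(r) = p(p-1)·(min(|r|, n))^{p-2} for every r ∈ ℝ. -/

import Mathlib

/-- The truncated power function `φ_n`: `φ_n(r) = |r|^p` for `|r| < n`, and the second-order
Taylor extension `n^{p-2} (p(p-1)/2)(|r|-n)² + p n^{p-1}(|r|-n) + n^p` for `|r| ≥ n`. -/
noncomputable def phi (p : ℝ) (n : ℕ) (r : ℝ) : ℝ :=
  if |r| < n then |r| ^ p
  else (n : ℝ) ^ (p - 2) * (p * (p - 1) / 2) * (|r| - n) ^ 2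
      + p * (n : ℝ) ^ (p - 1) * (|r| - n) + (n : ℝ) ^ p

open Set

/-- A function that coincides with `g` to the left of `a` and with `h` to the right of `a` is
differentiable wherever the relevant pieces are, with a common derivative at `a`. -/
theorem hasDerivAt_of_eq_pieces {f g h : ℝ → ℝ} {a b d r : ℝ} (hbr : b < r)
    (hg : ∀ x, b < x → x ≤ a → f x = g x) (hh : ∀ x, a ≤ x → f x = h x)
    (hg' : r ≤ a → HasDerivAt g d r) (hh' : a ≤ r → HasDerivAt h d r) :
    HasDerivAt f d r := by
  rcases lt_trichotomy r a with hr | rfl | hr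
  · refine (hg' hr.le).congr_of_eventuallyEq ?_
    filter_upwards [Ioo_mem_nhds hbr hr] with x hx using hg x hx.1 hx.2.le
  · have left : HasDerivWithinAt f d (Iic r) r := by
      refine (hg' le_rfl).hasDerivWithinAt.congr_of_eventuallyEq ?_ (hg r hbr le_rfl)
      filter_upwards [self_mem_nhdsWithin, mem_nhdsWithin_of_mem_nhds (Ioi_mem_nhds hbr)]
        with x hx hbx using hg x hbx hx
    have right : HasDerivWithinAt f d (Ici r) r :=
      (hh' le_rfl).hasDerivWithinAt.congr (fun x hx => hh x hx) (hh r le_rfl)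
    simpa using left.union right
  · refine (hh' hr.le).congr_of_eventuallyEq ?_
    filter_upwards [Ioi_mem_nhds hr] with x hx using hh x (le_of_lt hx)

theorem abs_rpow_sub_two_mul_self {p x : ℝ} (hp : 2 ≤ p) (hx : 0 ≤ x) :
    |x| ^ (p - 2) * x = x ^ (p - 1) := by
  rw [abs_of_nonneg hx, ← Real.rpow_add_one' hx (by linarith)]
  congr 1
  ring

theorem hasDerivAt_abs_rpow_sub_two_mul_self {p : ℝ} (hp : 2 ≤ p) (r : ℝ) :
    HasDerivAt (fun x : ℝ => |x| ^ (p - 2) * x) ((p - 1) * |r| ^ (p - 2)) r := by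
  refine hasDerivAt_of_eq_pieces (g := fun x => -(-x) ^ (p - 1)) (h := fun x => x ^ (p - 1))
    (a := 0) (sub_one_lt r) (fun x _ hx => ?_) (fun x hx => abs_rpow_sub_two_mul_self hp hx)
    (fun hr => ?_) (fun hr => ?_)
  · rw [← abs_rpow_sub_two_mul_self hp (neg_nonneg.2 hx), abs_neg]
    ring
  · refine ((hasDerivAt_neg r).rpow_const (p := p - 1) (Or.inr (by linarith))).neg.congr_deriv ?_
    rw [abs_of_nonpos hr, show p - 1 - 1 = p - 2 by ring]
    ring
  · convert Real.hasDerivAt_rpow_const (x := r) (p := p - 1) (Or.inr (by linarith)) using 1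
    rw [abs_of_nonneg hr, show p - 1 - 1 = p - 2 by ring]

/-- The first derivative of `phi p n`. -/
noncomputable def phiDeriv (p : ℝ) (n : ℕ) (r : ℝ) : ℝ :=
  if |r| < n then p * (|r| ^ (p - 2) * r)
  else Real.sign r * ((n : ℝ) ^ (p - 2) * (p * (p - 1)) * (|r| - n) + p * (n : ℝ) ^ (p - 1))

theorem phi_neg (p : ℝ) (n : ℕ) (r : ℝ) : phi p n (-r) = phi p n r := by
  simp only [phi, abs_neg]

theorem phiDeriv_neg (p : ℝ) (n : ℕ) (r : ℝ) : phiDeriv p n (-r) = -phiDeriv p n r := by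
  simp only [phiDeriv, abs_neg, Real.sign_neg]
  split_ifs <;> ring

theorem phi_of_abs_le {p : ℝ} {n : ℕ} {r : ℝ} (hr : |r| ≤ n) : phi p n r = |r| ^ p := by
  rcases hr.lt_or_eq with h | h
  · simp [phi, h]
  · simp [phi, h]

theorem phi_of_le {p : ℝ} {n : ℕ} {r : ℝ} (hr : (n : ℝ) ≤ r) :
    phi p n r = (n : ℝ) ^ (p - 2) * (p * (p - 1) / 2) * (r - n) ^ 2
      + p * (n : ℝ) ^ (p - 1) * (r - n) + (n : ℝ) ^ p := by
  have h : |r| = r := abs_of_nonneg (n.cast_nonneg.trans hr)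
  rw [phi, h, if_neg hr.not_gt]

theorem phiDeriv_of_le {p : ℝ} {n : ℕ} (hn : 1 ≤ n) {r : ℝ} (hr : (n : ℝ) ≤ r) :
    phiDeriv p n r = (n : ℝ) ^ (p - 2) * (p * (p - 1)) * (r - n) + p * (n : ℝ) ^ (p - 1) := by
  have h0 : 0 < r := lt_of_lt_of_le (by exact_mod_cast hn) hr
  rw [phiDeriv, abs_of_pos h0, if_neg hr.not_gt, Real.sign_of_pos h0, one_mul]

theorem phiDeriv_of_mem_Ioc {p : ℝ} (hp : 2 ≤ p) {n : ℕ} (hn : 1 ≤ n) {r : ℝ}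
    (hr : r ∈ Ioc (-(n : ℝ)) n) : phiDeriv p n r = p * (|r| ^ (p - 2) * r) := by
  rcases hr.2.lt_or_eq with h | rfl
  · rw [phiDeriv, if_pos (abs_lt.2 ⟨hr.1, h⟩)]
  · rw [phiDeriv_of_le hn le_rfl, abs_rpow_sub_two_mul_self hp n.cast_nonneg]
    ring

theorem hasDerivAt_phi {p : ℝ} (hp : 2 ≤ p) {n : ℕ} (hn : 1 ≤ n) (r : ℝ) :
    HasDerivAt (phi p n) (phiDeriv p n r) r := by
  have hn0 : (0 : ℝ) < n := by exact_mod_cast hn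
  have nonneg : ∀ r : ℝ, 0 ≤ r → HasDerivAt (phi p n) (phiDeriv p n r) r := by
    intro r hr
    have hbr : -(n : ℝ) < r := by linarith
    refine hasDerivAt_of_eq_pieces hbr
      (fun x hx hxn => phi_of_abs_le (abs_le.2 ⟨hx.le, hxn⟩)) (fun x hx => phi_of_le hx)
      (fun h => ?_) (fun h => ?_)
    · rw [phiDeriv_of_mem_Ioc hp hn ⟨hbr, h⟩, ← mul_assoc]
      exact hasDerivAt_abs_rpow r (by linarith)
    · rw [phiDeriv_of_le hn h]
      have hd := (hasDerivAt_id' r).sub_const (n : ℝ)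
      refine ((((hd.pow 2).const_mul ((n : ℝ) ^ (p - 2) * (p * (p - 1) / 2))).add
        (hd.const_mul (p * (n : ℝ) ^ (p - 1)))).add_const ((n : ℝ) ^ p)).congr_deriv ?_
      norm_num
      ring
  rcases le_total 0 r with hr | hr
  · exact nonneg r hr
  · have h := (nonneg (-r) (neg_nonneg.2 hr)).comp r (hasDerivAt_neg r)
    rw [phiDeriv_neg] at h
    simpa [Function.comp_def, phi_neg] using h

theorem hasDerivAt_phiDeriv {p : ℝ} (hp : 2 ≤ p) {n : ℕ} (hn : 1 ≤ n) (r : ℝ) :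
    HasDerivAt (phiDeriv p n) (p * (p - 1) * (min |r| (n : ℝ)) ^ (p - 2)) r := by
  have hn0 : (0 : ℝ) < n := by exact_mod_cast hn
  have nonneg : ∀ r : ℝ, 0 ≤ r →
      HasDerivAt (phiDeriv p n) (p * (p - 1) * (min |r| (n : ℝ)) ^ (p - 2)) r := by
    intro r hr
    have hbr : -(n : ℝ) < r := by linarith
    refine hasDerivAt_of_eq_pieces hbr
      (fun x hx hxn => phiDeriv_of_mem_Ioc hp hn ⟨hx, hxn⟩) (fun x hx => phiDeriv_of_le hn hx)
      (fun h => ?_) (fun h => ?_)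
    · rw [min_eq_left (abs_le.2 ⟨hbr.le, h⟩), mul_assoc]
      exact (hasDerivAt_abs_rpow_sub_two_mul_self hp r).const_mul p
    · rw [min_eq_right (h.trans (le_abs_self r))]
      refine ((((hasDerivAt_id' r).sub_const (n : ℝ)).const_mul
        ((n : ℝ) ^ (p - 2) * (p * (p - 1)))).add_const (p * (n : ℝ) ^ (p - 1))).congr_deriv ?_
      ring
  rcases le_total 0 r with hr | hr
  · exact nonneg r hr
  · have h := ((nonneg (-r) (neg_nonneg.2 hr)).comp r (hasDerivAt_neg r)).neg
    simpa [Function.comp_def, phiDeriv_neg, Pi.neg_def] using h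

/-- For `p ≥ 2` and `n ≥ 1`, the function `φ_n` is twice continuously
differentiable on `ℝ` and `φ_n''(r) = p(p-1) (min(|r|, n))^{p-2}` for every `r`. -/
theorem statement4 (p : ℝ) (hp : 2 ≤ p) (n : ℕ) (hn : 1 ≤ n) :
    ContDiff ℝ 2 (phi p n) ∧
      ∀ r : ℝ, deriv (deriv (phi p n)) r = p * (p - 1) * (min |r| (n : ℝ)) ^ (p - 2) := by
  have h1 : deriv (phi p n) = phiDeriv p n := funext fun r => (hasDerivAt_phi hp hn r).deriv
  have h2 : deriv (phiDeriv p n) = fun r => p * (p - 1) * (min |r| (n : ℝ)) ^ (p - 2) :=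
    funext fun r => (hasDerivAt_phiDeriv hp hn r).deriv
  refine ⟨?_, fun r => by rw [h1, h2]⟩
  rw [show (2 : WithTop ℕ∞) = 1 + 1 by norm_num, contDiff_succ_iff_deriv, h1,
    contDiff_one_iff_deriv, h2]
  refine ⟨fun r => (hasDerivAt_phi hp hn r).differentiableAt, by simp,
    fun r => (hasDerivAt_phiDeriv hp hn r).differentiableAt, ?_⟩
  exact continuous_const.mul
    ((continuous_abs.min continuous_const).rpow_const fun _ => Or.inr (by linarith))
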